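/- There exists a constant C > 0, independent of Φ, α, n and F, such that for every Φ > 0, every α ≥ 0, every nonzero integer n, and every smooth solution v of the n-th mode swirl problem with right-hand side F, the following three estimates hold: (i) ∫₀¹ |v(r)|²·r dr ≤ C·(Φ·|n|)^{−4/3}·∫₀¹ |F(r)|²·r dr; (ii) ∫₀¹ |(d/dr)(r·v(r))|²·(1/r) dr + n²·∫₀¹ |v(r)|²·r dr ≤ C·(Φ·|n|)^{−2/3}·∫₀¹ |F(r)|²·r dr; (iii) ∫₀¹ |((𝓛 − n²)v)(r)|²·r dr ≤ C·∫₀¹ |F(r)|²·r dr. (Estimates (swirl-36), (swirl-37), (swirl-39) from the proof of Proposition 4.1: uniform estimates for the nonzero modes of the swirl velocity.) -/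

import Mathlib

open MeasureTheory Filter

/-- One-sided derivative on `(0,1]`. -/
noncomputable def dz (g : ℝ → ℂ) : ℝ → ℂ := derivWithin g (Set.Ioc 0 1)

/-- The operator `(𝓛 g)(r) = g''(r) + (1/r) g'(r) − (1/r²) g(r)`. -/
noncomputable def Lop (g : ℝ → ℂ) : ℝ → ℂ := fun r =>
  dz (dz g) r + ((r : ℂ))⁻¹ * dz g r - (((r : ℂ)) ^ 2)⁻¹ * g r

/-- Weighted integral over `(0,1)` with values in `[0,∞]`. -/
noncomputable def wInt (h : ℝ → ℝ) : ENNReal :=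
  ∫⁻ r in Set.Ioo (0 : ℝ) 1, ENNReal.ofReal (h r)

/-- The Poiseuille profile `Ū(r) = ((4+2α)/(4+α)) (1 − (2α/(4+2α)) r²) (Φ/π)`. -/
noncomputable def Ubar (Φ α : ℝ) : ℝ → ℝ := fun r =>
  (4 + 2 * α) / (4 + α) * (1 - 2 * α / (4 + 2 * α) * r ^ 2) * (Φ / Real.pi)

/-- A smooth solution of the `n`-th mode swirl problem with right-hand side `F`:
`v` is twice continuously differentiable on `(0,1]`, `v` and `v'` extend continuously
to `[0,1]` with `v(0) = 0`, `i n Ū v − (𝓛 − n²)v = F` on `(0,1)`,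
`v'(1) = (1 − α) v(1)`, and the relevant weighted integrals are finite. -/
structure SwirlSol (Φ α : ℝ) (n : ℤ) (F v : ℝ → ℂ) : Prop where
  smooth : ContDiffOn ℝ 2 v (Set.Ioc 0 1)
  /-- `v` extends continuously to `[0,1]` with `v(0) = 0`. -/
  ext_v : Filter.Tendsto v (nhdsWithin (0 : ℝ) (Set.Ioc 0 1)) (nhds (0 : ℂ))
  /-- `v'` extends continuously to `[0,1]`. -/
  ext_dv : ∃ L : ℂ, Filter.Tendsto (dz v) (nhdsWithin (0 : ℝ) (Set.Ioc 0 1)) (nhds L)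
  eqn : ∀ r ∈ Set.Ioo (0 : ℝ) 1,
    Complex.I * (n : ℂ) * (Ubar Φ α r : ℂ) * v r
      - (Lop v r - (n : ℂ) ^ 2 * v r) = F r
  bc : dz v 1 = (1 - (α : ℂ)) * v 1
  fin_v : wInt (fun r => ‖v r‖ ^ 2 * r) < ⊤
  fin_dv : wInt (fun r => ‖dz (fun s => (s : ℂ) * v s) r‖ ^ 2 / r) < ⊤
  fin_Lv : wInt (fun r => ‖Lop v r‖ ^ 2 * r) < ⊤

/-- Real form of the mode problem (real and imaginary parts), extended continuously to `[0,1]`. -/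
structure RealSol (m c α : ℝ) (U U1 x y x1 y1 x2 y2 p q : ℝ → ℝ) : Prop where
  cx : ContinuousOn x (Set.Icc 0 1)
  cy : ContinuousOn y (Set.Icc 0 1)
  cx1 : ContinuousOn x1 (Set.Icc 0 1)
  cy1 : ContinuousOn y1 (Set.Icc 0 1)
  cU : ContinuousOn U (Set.Icc 0 1)
  x0 : x 0 = 0
  y0 : y 0 = 0
  dx : ∀ r ∈ Set.Ioo (0 : ℝ) 1, HasDerivAt x (x1 r) r
  dy : ∀ r ∈ Set.Ioo (0 : ℝ) 1, HasDerivAt y (y1 r) r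
  dx1 : ∀ r ∈ Set.Ioo (0 : ℝ) 1, HasDerivAt x1 (x2 r) r
  dy1 : ∀ r ∈ Set.Ioo (0 : ℝ) 1, HasDerivAt y1 (y2 r) r
  dU : ∀ r ∈ Set.Ioo (0 : ℝ) 1, HasDerivAt U (U1 r) r
  Ulow : ∀ r ∈ Set.Ioo (0 : ℝ) 1, c * (1 - r ^ 2) ≤ U r
  U1le : ∀ r ∈ Set.Ioo (0 : ℝ) 1, |U1 r| ≤ 4 * c * r
  e1 : ∀ r ∈ Set.Ioo (0 : ℝ) 1,
    x2 r = m ^ 2 * x r - m * U r * y r - p r - x1 r / r + x r / r ^ 2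
  e2 : ∀ r ∈ Set.Ioo (0 : ℝ) 1,
    y2 r = m ^ 2 * y r + m * U r * x r - q r - y1 r / r + y r / r ^ 2
  b1 : x1 1 = (1 - α) * x 1
  b2 : y1 1 = (1 - α) * y 1
  c0 : 0 < c
  α0 : 0 ≤ α
  m1 : 1 ≤ m ^ 2
  ia : IntegrableOn (fun r => ((r * x1 r - x r) ^ 2 + (r * y1 r - y r) ^ 2) / r) (Set.Ioo 0 1)
  jf : IntegrableOn (fun r => r * (p r ^ 2 + q r ^ 2)) (Set.Ioo 0 1)

lemma ftc_le {G g φ : ℝ → ℝ} (hG : ContinuousOn G (Set.Icc 0 1))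
    (hd : ∀ r ∈ Set.Ioo (0 : ℝ) 1, HasDerivAt G (g r) r)
    (hφ : IntegrableOn φ (Set.Ioo 0 1))
    (hle : ∀ r ∈ Set.Ioo (0 : ℝ) 1, g r ≤ φ r) :
    G 1 - G 0 ≤ ∫ r in Set.Ioo (0 : ℝ) 1, φ r := by
  have h := intervalIntegral.sub_le_integral_of_hasDeriv_right_of_le (a := 0) (b := 1)
    zero_le_one hG (fun r hr => (hd r hr).hasDerivWithinAt)
    ((integrableOn_Icc_iff_integrableOn_Ioo (by simp) (by simp)).2 hφ) hle
  rwa [intervalIntegral.integral_of_le zero_le_one, integral_Ioc_eq_integral_Ioo] at h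

section
variable {m c α : ℝ} {U U1 x y x1 y1 x2 y2 p q : ℝ → ℝ}

/-- abbreviations for the basic quadratic densities -/
noncomputable def aD (x y x1 y1 : ℝ → ℝ) : ℝ → ℝ :=
  fun r => ((r * x1 r - x r) ^ 2 + (r * y1 r - y r) ^ 2) / r

/-- density of the weighted square norm -/
def bD (x y : ℝ → ℝ) : ℝ → ℝ := fun r => r * (x r ^ 2 + y r ^ 2)

/-- density with the weight `1 - r^2` -/
def kD (x y : ℝ → ℝ) : ℝ → ℝ := fun r => (1 - r ^ 2) * bD x y r

/-- density with the weight `m^2 U^2` -/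
def dD (m : ℝ) (U x y : ℝ → ℝ) : ℝ → ℝ := fun r => m ^ 2 * U r ^ 2 * bD x y r

/-- density of `|(r v)'|^2 / r` -/
noncomputable def wD (x y x1 y1 : ℝ → ℝ) : ℝ → ℝ :=
  fun r => ((r * x1 r + x r) ^ 2 + (r * y1 r + y r) ^ 2) / r

lemma iadd {f g : ℝ → ℝ} {s : Set ℝ} (hf : IntegrableOn f s) (hg : IntegrableOn g s) :
    IntegrableOn (fun r => f r + g r) s := hf.add hg

lemma isub {f g : ℝ → ℝ} {s : Set ℝ} (hf : IntegrableOn f s) (hg : IntegrableOn g s) :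
    IntegrableOn (fun r => f r - g r) s := hf.sub hg

lemma cont_int {g : ℝ → ℝ} (h : ContinuousOn g (Set.Icc 0 1)) : IntegrableOn g (Set.Ioo 0 1) :=
  (h.integrableOn_Icc).mono_set Set.Ioo_subset_Icc_self

namespace RealSol

lemma cb (h : RealSol m c α U U1 x y x1 y1 x2 y2 p q) : ContinuousOn (bD x y) (Set.Icc 0 1) := by
  have := h.cx; have := h.cy
  unfold bD; fun_prop

lemma ib (h : RealSol m c α U U1 x y x1 y1 x2 y2 p q) : IntegrableOn (bD x y) (Set.Ioo 0 1) :=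
  cont_int h.cb

lemma ik (h : RealSol m c α U U1 x y x1 y1 x2 y2 p q) : IntegrableOn (kD x y) (Set.Ioo 0 1) := by
  have := h.cb
  apply cont_int; unfold kD; fun_prop

lemma id' (h : RealSol m c α U U1 x y x1 y1 x2 y2 p q) :
    IntegrableOn (dD m U x y) (Set.Ioo 0 1) := by
  have := h.cb; have := h.cU
  apply cont_int; unfold dD; fun_prop

lemma ia' (h : RealSol m c α U U1 x y x1 y1 x2 y2 p q) :
    IntegrableOn (aD x y x1 y1) (Set.Ioo 0 1) := h.ia

lemma wD_eq {r : ℝ} (hr : r ≠ 0) :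
    wD x y x1 y1 r = aD x y x1 y1 r + 4 * (x r * x1 r + y r * y1 r) := by
  unfold wD aD; field_simp; ring

lemma iw (h : RealSol m c α U U1 x y x1 y1 x2 y2 p q) :
    IntegrableOn (wD x y x1 y1) (Set.Ioo 0 1) := by
  have h1 : IntegrableOn (fun r => 4 * (x r * x1 r + y r * y1 r)) (Set.Ioo 0 1) := by
    have := h.cx; have := h.cy; have := h.cx1; have := h.cy1
    apply cont_int; fun_prop
  exact (h.ia'.add h1).congr_fun (fun r hr => (wD_eq hr.1.ne').symm) measurableSet_Ioo

lemma b_nonneg {r : ℝ} (hr : r ∈ Set.Ioo (0 : ℝ) 1) : 0 ≤ bD x y r :=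
  mul_nonneg hr.1.le (by positivity)

lemma a_nonneg {r : ℝ} (hr : r ∈ Set.Ioo (0 : ℝ) 1) : 0 ≤ aD x y x1 y1 r :=
  div_nonneg (by positivity) hr.1.le

/-- cross term estimate -/
lemma cross {r t s : ℝ} (hr : r ∈ Set.Ioo (0 : ℝ) 1) (ht : 0 < t) (u w : ℝ)
    (hu : u ^ 2 + w ^ 2 ≤ s ^ 2) :
    r * (u * ((r * x1 r - x r) * x r + (r * y1 r - y r) * y r)
      + w * ((r * y1 r - y r) * x r - (r * x1 r - x r) * y r)) * 2
    ≤ s ^ 2 * t * aD x y x1 y1 r + bD x y r / t := by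
  obtain ⟨h0, h1⟩ := hr
  unfold aD bD
  set z1 := r * x1 r - x r
  set z2 := r * y1 r - y r
  have e : s ^ 2 * t * ((z1 ^ 2 + z2 ^ 2) / r) + r * (x r ^ 2 + y r ^ 2) / t
      - r * (u * (z1 * x r + z2 * y r) + w * (z2 * x r - z1 * y r)) * 2
      = ((s ^ 2 - (u ^ 2 + w ^ 2) * r ^ 2) * t ^ 2 * (z1 ^ 2 + z2 ^ 2)
        + r ^ 2 * ((x r - t * (u * z1 + w * z2)) ^ 2 + (y r - t * (u * z2 - w * z1)) ^ 2))
        / (r * t) := by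
    field_simp; ring
  have : 0 ≤ s ^ 2 - (u ^ 2 + w ^ 2) * r ^ 2 := by
    have : (u ^ 2 + w ^ 2) * r ^ 2 ≤ (u ^ 2 + w ^ 2) * 1 := by
      apply mul_le_mul_of_nonneg_left _ (by positivity)
      nlinarith
    linarith
  rw [← sub_nonneg, e]
  positivity

lemma young {r t : ℝ} (hr : 0 < r) (ht : 0 < t) (P Q X Y : ℝ) :
    r * (P * X + Q * Y) ≤ (r * (P ^ 2 + Q ^ 2)) / (2 * t) + t / 2 * (r * (X ^ 2 + Y ^ 2)) := by
  have e : (r * (P ^ 2 + Q ^ 2)) / (2 * t) + t / 2 * (r * (X ^ 2 + Y ^ 2)) - r * (P * X + Q * Y)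
    = r * ((P - t * X) ^ 2 + (Q - t * Y) ^ 2) / (2 * t) := by field_simp; ring
  rw [← sub_nonneg, e]; positivity

lemma energy (h : RealSol m c α U U1 x y x1 y1 x2 y2 p q) {t : ℝ} (ht : 0 < t) :
    (∫ r in Set.Ioo (0 : ℝ) 1, aD x y x1 y1 r) + m ^ 2 * (∫ r in Set.Ioo (0 : ℝ) 1, bD x y r)
    ≤ (∫ r in Set.Ioo (0 : ℝ) 1, r * (p r ^ 2 + q r ^ 2)) / (2 * t)
      + t / 2 * (∫ r in Set.Ioo (0 : ℝ) 1, bD x y r) := by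
  have hcx := h.cx; have hcy := h.cy; have hcx1 := h.cx1; have hcy1 := h.cy1
  have hInt : IntegrableOn (fun r => (r * (p r ^ 2 + q r ^ 2)) / (2 * t) + t / 2 * bD x y r
      - aD x y x1 y1 r - m ^ 2 * bD x y r) (Set.Ioo 0 1) :=
    (((h.jf.div_const _).add (h.ib.const_mul _)).sub h.ia').sub (h.ib.const_mul _)
  have key := ftc_le (G := fun r => -((r * x1 r - x r) * x r + (r * y1 r - y r) * y r))
    (by fun_prop)
    (fun r hr => ((((((hasDerivAt_id' r).mul (h.dx1 r hr)).sub (h.dx r hr)).mul (h.dx r hr)).add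
      ((((hasDerivAt_id' r).mul (h.dy1 r hr)).sub (h.dy r hr)).mul (h.dy r hr))).neg)) hInt
    (by
      intro r hr
      have hy := young hr.1 ht (p r) (q r) (x r) (y r)
      have hr0 := hr.1.ne'
      simp only [Pi.mul_apply, Pi.sub_apply]
      rw [h.e1 r hr, h.e2 r hr]
      have : -((1 * x1 r + r * (m ^ 2 * x r - m * U r * y r - p r - x1 r / r + x r / r ^ 2)
          - x1 r) * x r + (r * x1 r - x r) * x1 r
          + ((1 * y1 r + r * (m ^ 2 * y r + m * U r * x r - q r - y1 r / r + y r / r ^ 2)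
          - y1 r) * y r + (r * y1 r - y r) * y1 r)) = r * (p r * x r + q r * y r)
          - aD x y x1 y1 r - m ^ 2 * bD x y r := by
        unfold aD bD; field_simp; ring
      unfold bD at *
      linarith)
  rw [integral_sub (isub (iadd (h.jf.div_const _) (h.ib.const_mul _)) h.ia') (h.ib.const_mul _),
    integral_sub (iadd (h.jf.div_const _) (h.ib.const_mul _)) h.ia',
    integral_add (h.jf.div_const _) (h.ib.const_mul _), integral_const_mul,
    integral_const_mul, integral_div] at key
  simp only [h.x0, h.y0, h.b1, h.b2] at key
  have := mul_nonneg h.α0 (add_nonneg (sq_nonneg (x 1)) (sq_nonneg (y 1)))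
  nlinarith

lemma imag (h : RealSol m c α U U1 x y x1 y1 x2 y2 p q) {t : ℝ} (ht : 0 < t) :
    |m| * c * (∫ r in Set.Ioo (0 : ℝ) 1, kD x y r)
    ≤ (∫ r in Set.Ioo (0 : ℝ) 1, r * (p r ^ 2 + q r ^ 2)) / (2 * t)
      + t / 2 * (∫ r in Set.Ioo (0 : ℝ) 1, bD x y r) := by
  have hcx := h.cx; have hcy := h.cy; have hcx1 := h.cx1; have hcy1 := h.cy1
  obtain ⟨σ, hσ, hσm⟩ : ∃ σ : ℝ, σ ^ 2 = 1 ∧ σ * m = |m| := by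
    rcases abs_cases m with hm | hm
    · exact ⟨1, by norm_num, by linarith⟩
    · exact ⟨-1, by norm_num, by linarith⟩
  have hInt : IntegrableOn (fun r => (r * (p r ^ 2 + q r ^ 2)) / (2 * t) + t / 2 * bD x y r
      - |m| * c * kD x y r) (Set.Ioo 0 1) :=
    (((h.jf.div_const _).add (h.ib.const_mul _)).sub (h.ik.const_mul _))
  have key := ftc_le (G := fun r => -σ * (r * (y1 r * x r - x1 r * y r)))
    (by fun_prop)
    (fun r hr => (((hasDerivAt_id' r).mul (((h.dy1 r hr).mul (h.dx r hr)).sub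
      ((h.dx1 r hr).mul (h.dy r hr)))).const_mul (-σ))) hInt
    (by
      intro r hr
      have hy := young hr.1 ht (-σ * p r) (σ * q r) (y r) (x r)
      have hr0 := hr.1.ne'
      simp only [Pi.mul_apply, Pi.sub_apply]
      rw [h.e1 r hr, h.e2 r hr]
      have e : -σ * (1 * (y1 r * x r - x1 r * y r) + r *
          ((m ^ 2 * y r + m * U r * x r - q r - y1 r / r + y r / r ^ 2) * x r + y1 r * x1 r
          - ((m ^ 2 * x r - m * U r * y r - p r - x1 r / r + x r / r ^ 2) * y r + x1 r * y1 r)))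
          = r * (-σ * p r * y r + σ * q r * x r) - (σ * m) * (U r * bD x y r) := by
        unfold bD; field_simp; ring
      have e2 : r * ((-σ * p r) ^ 2 + (σ * q r) ^ 2) = r * (p r ^ 2 + q r ^ 2) := by
        linear_combination r * (p r ^ 2 + q r ^ 2) * hσ
      have e3 : |m| * (c * kD x y r) ≤ |m| * (U r * bD x y r) := by
        apply mul_le_mul_of_nonneg_left _ (abs_nonneg m)
        unfold kD; rw [← mul_assoc]
        exact mul_le_mul_of_nonneg_right (h.Ulow r hr) (b_nonneg hr)
      rw [e2] at hy
      rw [e, hσm]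
      have e4 : bD x y r = r * (y r ^ 2 + x r ^ 2) := by unfold bD; ring
      rw [← e4] at hy
      linarith)
  rw [integral_sub (iadd (h.jf.div_const _) (h.ib.const_mul _)) (h.ik.const_mul _),
    integral_add (h.jf.div_const _) (h.ib.const_mul _), integral_const_mul,
    integral_const_mul, integral_div] at key
  simp only [h.x0, h.y0, h.b1, h.b2] at key
  have : -σ * (1 * ((1 - α) * y 1 * x 1 - (1 - α) * x 1 * y 1))
    - -σ * (0 * (y1 0 * 0 - x1 0 * 0)) = 0 := by ring
  linarith

lemma interp (h : RealSol m c α U U1 x y x1 y1 x2 y2 p q) {δ : ℝ} (hδ : 0 < δ) :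
    (∫ r in Set.Ioo (0 : ℝ) 1, bD x y r) ≤ (6 + 4 / δ) * (∫ r in Set.Ioo (0 : ℝ) 1, kD x y r)
      + δ ^ 2 * ∫ r in Set.Ioo (0 : ℝ) 1, aD x y x1 y1 r := by
  have hcx := h.cx; have hcy := h.cy; have hcx1 := h.cx1; have hcy1 := h.cy1
  have hInt : IntegrableOn (fun r => (6 + 4 / δ) * kD x y r + δ ^ 2 * aD x y x1 y1 r
      - bD x y r) (Set.Ioo 0 1) :=
    (((h.ik.const_mul _).add (h.ia'.const_mul _)).sub h.ib)
  have hpos : ∀ r ∈ Set.Icc (0 : ℝ) 1, 1 - r ^ 2 + δ ≠ 0 := by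
    intro r hr
    have : 0 ≤ 1 - r ^ 2 := by nlinarith [hr.1, hr.2]
    positivity
  have hdφ : ∀ r ∈ Set.Ioo (0 : ℝ) 1, HasDerivAt (fun r : ℝ => δ * (1 - r ^ 2) / (1 - r ^ 2 + δ))
      (- (2 * r * (δ ^ 2 / (1 - r ^ 2 + δ) ^ 2))) r := by
    intro r hr
    have hp := hpos r ⟨hr.1.le, hr.2.le⟩
    have h1 : HasDerivAt (fun r : ℝ => 1 - r ^ 2) (-(2 * r)) r := by
      simpa using ((hasDerivAt_id' r).pow 2).const_sub 1
    refine ((h1.const_mul δ).div (h1.add_const δ) hp).congr_deriv ?_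
    field_simp; ring
  have hcφ : ContinuousOn (fun r : ℝ => δ * (1 - r ^ 2) / (1 - r ^ 2 + δ)) (Set.Icc 0 1) :=
    ContinuousOn.div (by fun_prop) (by fun_prop) hpos
  have hcG : ContinuousOn (fun r => (δ * (1 - r ^ 2) / (1 - r ^ 2 + δ)) *
      (r * (r * (x r ^ 2 + y r ^ 2)))) (Set.Icc 0 1) := hcφ.mul (by fun_prop)
  have key := ftc_le hcG
    (fun r hr => ((hdφ r hr).mul ((hasDerivAt_id' r).mul ((hasDerivAt_id' r).mul
      (((h.dx r hr).pow 2).add ((h.dy r hr).pow 2)))))) hInt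
    (by
      intro r hr
      have hr0 := hr.1.ne'
      have hs : 0 < 1 - r ^ 2 := by nlinarith [hr.1, hr.2]
      have hb := b_nonneg (x := x) (y := y) hr
      set φ := δ * (1 - r ^ 2) / (1 - r ^ 2 + δ) with hφ
      set ψ := δ ^ 2 / (1 - r ^ 2 + δ) ^ 2 with hψ
      have hφ0 : 0 ≤ φ := by positivity
      have hφδ : φ ≤ δ := by
        rw [hφ, div_le_iff₀ (by positivity)]; nlinarith
      have hφs : φ ≤ 1 - r ^ 2 := by
        rw [hφ, div_le_iff₀ (by positivity)]; nlinarith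
      have hψ1 : 1 - 2 * (1 - r ^ 2) / δ ≤ ψ := by
        rw [hψ, le_div_iff₀ (by positivity)]
        have : δ ^ 2 - (1 - 2 * (1 - r ^ 2) / δ) * (1 - r ^ 2 + δ) ^ 2
          = (1 - r ^ 2) ^ 2 * (3 * δ + 2 * (1 - r ^ 2)) / δ := by field_simp; ring
        have h2 : 0 ≤ (1 - r ^ 2) ^ 2 * (3 * δ + 2 * (1 - r ^ 2)) / δ := by positivity
        linarith
      have hc := cross (x := x) (y := y) (x1 := x1) (y1 := y1) (s := δ) (t := 1) hr one_pos φ 0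
        (by nlinarith)
      have e : -(2 * r * ψ) * (r * (r * (x r ^ 2 + y r ^ 2))) + φ *
          (1 * (r * (x r ^ 2 + y r ^ 2)) + r * (1 * (x r ^ 2 + y r ^ 2) +
          r * (2 * x r ^ (2 - 1) * x1 r + 2 * y r ^ (2 - 1) * y1 r)))
          = r * (φ * ((r * x1 r - x r) * x r + (r * y1 r - y r) * y r)
            + 0 * ((r * y1 r - y r) * x r - (r * x1 r - x r) * y r)) * 2
            + (4 * φ - 2 * r ^ 2 * ψ) * bD x y r := by
        unfold bD; norm_num; ring
      have hfac : 4 * φ - 2 * r ^ 2 * ψ + 1 ≤ (6 + 4 / δ) * (1 - r ^ 2) - 1 := by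
        have h3 : r ^ 2 * (1 - 2 * (1 - r ^ 2) / δ) ≤ r ^ 2 * ψ :=
          mul_le_mul_of_nonneg_left hψ1 (sq_nonneg r)
        have h4 : 0 ≤ (1 - r ^ 2) ^ 2 / δ := by positivity
        have h5 : (6 + 4 / δ) * (1 - r ^ 2) - 1 - (4 * (1 - r ^ 2)
          - 2 * (r ^ 2 * (1 - 2 * (1 - r ^ 2) / δ)) + 1) = 4 * ((1 - r ^ 2) ^ 2 / δ) := by
          field_simp; ring
        linarith
      have := mul_le_mul_of_nonneg_right hfac hb
      have e' := e
      norm_num at e' hc ⊢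
      unfold kD
      linarith)
  rw [integral_sub (iadd (h.ik.const_mul _) (h.ia'.const_mul _)) h.ib,
    integral_add (h.ik.const_mul _) (h.ia'.const_mul _), integral_const_mul,
    integral_const_mul] at key
  norm_num at key
  linarith

lemma wbound (h : RealSol m c α U U1 x y x1 y1 x2 y2 p q) :
    (∫ r in Set.Ioo (0 : ℝ) 1, wD x y x1 y1 r) ≤ 3 * (∫ r in Set.Ioo (0 : ℝ) 1, aD x y x1 y1 r)
      + 10 * ∫ r in Set.Ioo (0 : ℝ) 1, bD x y r := by
  have hcx := h.cx; have hcy := h.cy; have hcx1 := h.cx1; have hcy1 := h.cy1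
  have hInt : IntegrableOn (fun r => 3 * aD x y x1 y1 r + 10 * bD x y r
      - wD x y x1 y1 r) (Set.Ioo 0 1) :=
    (((h.ia'.const_mul _).add (h.ib.const_mul _)).sub h.iw)
  have key := ftc_le (G := fun r => -2 * ((1 - r * r) * (x r * x r + y r * y r)))
    (by fun_prop)
    (fun r hr => (((((hasDerivAt_id' r).mul (hasDerivAt_id' r)).const_sub 1).mul
      (((h.dx r hr).mul (h.dx r hr)).add ((h.dy r hr).mul (h.dy r hr)))).const_mul (-2))) hInt
    (by
      intro r hr
      have hr0 := hr.1.ne'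
      have hc := cross (x := x) (y := y) (x1 := x1) (y1 := y1) (s := 1) (t := 1) hr one_pos 1 0
        (by norm_num)
      simp only [Pi.mul_apply, Pi.add_apply]
      rw [wD_eq hr0]
      unfold bD at *
      have : 0 ≤ r * (x r ^ 2 + y r ^ 2) := b_nonneg hr
      linarith)
  rw [integral_sub (iadd (h.ia'.const_mul _) (h.ib.const_mul _)) h.iw,
    integral_add (h.ia'.const_mul _) (h.ib.const_mul _), integral_const_mul,
    integral_const_mul] at key
  simp only [h.x0, h.y0] at key
  norm_num at key
  linarith

lemma dbound (h : RealSol m c α U U1 x y x1 y1 x2 y2 p q) {τ : ℝ} (hτ : 0 < τ) :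
    (∫ r in Set.Ioo (0 : ℝ) 1, dD m U x y r) ≤
      (∫ r in Set.Ioo (0 : ℝ) 1, r * (p r ^ 2 + q r ^ 2))
      + 4 * (|m| * c) * (τ * (∫ r in Set.Ioo (0 : ℝ) 1, aD x y x1 y1 r)
      + (∫ r in Set.Ioo (0 : ℝ) 1, bD x y r) / τ) := by
  have hcx := h.cx; have hcy := h.cy; have hcx1 := h.cx1; have hcy1 := h.cy1
  have hcU := h.cU
  have i0 := iadd (h.ia'.const_mul τ) (h.ib.div_const τ)
  have i1 := iadd h.jf (i0.const_mul (4 * (|m| * c)))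
  have hInt : IntegrableOn (fun r => r * (p r ^ 2 + q r ^ 2) + 4 * (|m| * c) *
      (τ * aD x y x1 y1 r + bD x y r / τ) - dD m U x y r) (Set.Ioo 0 1) := i1.sub h.id'
  have key := ftc_le (G := fun r => -2 * m * (U r * (r * (y1 r * x r - x1 r * y r))))
    (by fun_prop)
    (fun r hr => (((h.dU r hr).mul ((hasDerivAt_id' r).mul (((h.dy1 r hr).mul (h.dx r hr)).sub
      ((h.dx1 r hr).mul (h.dy r hr))))).const_mul (-2 * m))) hInt
    (by
      intro r hr
      have hr0 := hr.1.ne'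
      have hy := young hr.1 one_pos (- p r) (q r) (m * U r * y r) (m * U r * x r)
      have hmc : 0 ≤ |m| * c := mul_nonneg (abs_nonneg _) h.c0.le
      have hU1 : (-(m * U1 r)) ^ 2 ≤ (4 * (|m| * c) * r) ^ 2 := by
        rw [sq_le_sq, abs_neg, abs_mul, abs_of_nonneg (by have := hr.1; positivity : 0 ≤ 4 * (|m| * c) * r)]
        have := mul_le_mul_of_nonneg_left (h.U1le r hr) (abs_nonneg m)
        linarith
      simp only [Pi.mul_apply, Pi.sub_apply]
      rw [h.e1 r hr, h.e2 r hr]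
      have e : -2 * m * (U1 r * (r * (y1 r * x r - x1 r * y r)) + U r * (1 * (y1 r * x r - x1 r * y r) + r *
          ((m ^ 2 * y r + m * U r * x r - q r - y1 r / r + y r / r ^ 2) * x r + y1 r * x1 r
          - ((m ^ 2 * x r - m * U r * y r - p r - x1 r / r + x r / r ^ 2) * y r + x1 r * y1 r))))
          = 2 * (r * (-p r * (m * U r * y r) + q r * (m * U r * x r))) - 2 * dD m U x y r
            - 2 * (m * U1 r) * ((r * y1 r - y r) * x r - (r * x1 r - x r) * y r) := by
        unfold dD bD; field_simp; ring
      rw [e]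
      have hd : r * ((m * U r * y r) ^ 2 + (m * U r * x r) ^ 2) = dD m U x y r := by
        unfold dD bD; ring
      rw [hd] at hy
      have hc := cross (x := x) (y := y) (x1 := x1) (y1 := y1) (s := 1) (t := τ) hr hτ 0
        (-(m * U1 r) / (4 * (|m| * c) * r)) (by
          have : 0 < |m| := abs_pos.2 (by
            intro h0; have := h.m1; rw [h0] at this; norm_num at this)
          have := h.c0; have := hr.1
          rw [div_pow]
          have hp : 0 < (4 * (|m| * c) * r) ^ 2 := by positivity
          have := (div_le_one hp).2 hU1
          linarith)
      have hc2 := mul_le_mul_of_nonneg_left hc (by positivity : 0 ≤ 4 * (|m| * c))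
      have hm : 0 < |m| := abs_pos.2 (by
        intro h0; have := h.m1; rw [h0] at this; norm_num at this)
      have hcc := h.c0.ne'
      have e5 : 4 * (|m| * c) * (r * (0 * ((r * x1 r - x r) * x r + (r * y1 r - y r) * y r)
          + -(m * U1 r) / (4 * (|m| * c) * r) * ((r * y1 r - y r) * x r - (r * x1 r - x r) * y r)) * 2)
          = - 2 * (m * U1 r) * ((r * y1 r - y r) * x r - (r * x1 r - x r) * y r) := by
        have := hm.ne'
        field_simp; ring
      rw [e5] at hc2
      have e6 : r * ((-p r) ^ 2 + q r ^ 2) = r * (p r ^ 2 + q r ^ 2) := by ring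
      rw [e6] at hy
      linarith)
  rw [integral_sub i1 h.id', integral_add h.jf (i0.const_mul (4 * (|m| * c))), integral_const_mul,
    integral_add (h.ia'.const_mul τ) (h.ib.div_const τ), integral_const_mul,
    integral_div] at key
  simp only [h.x0, h.y0, h.b1, h.b2] at key
  have : -2 * m * (U 1 * (1 * ((1 - α) * y 1 * x 1 - (1 - α) * x 1 * y 1)))
    - -2 * m * (U 0 * (0 * (y1 0 * 0 - x1 0 * 0))) = 0 := by ring
  linarith

lemma final (h : RealSol m c α U U1 x y x1 y1 x2 y2 p q) {δ : ℝ} (hδ : 0 < δ)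
    (hδ3 : |m| * c * δ ^ 3 = 1) :
    (∫ r in Set.Ioo (0 : ℝ) 1, bD x y r)
      ≤ 121 * δ ^ 4 * (∫ r in Set.Ioo (0 : ℝ) 1, r * (p r ^ 2 + q r ^ 2)) ∧
    (∫ r in Set.Ioo (0 : ℝ) 1, wD x y x1 y1 r) + m ^ 2 * (∫ r in Set.Ioo (0 : ℝ) 1, bD x y r)
      ≤ 121 * δ ^ 2 * (∫ r in Set.Ioo (0 : ℝ) 1, r * (p r ^ 2 + q r ^ 2)) ∧
    (∫ r in Set.Ioo (0 : ℝ) 1, dD m U x y r)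
      ≤ 529 * (∫ r in Set.Ioo (0 : ℝ) 1, r * (p r ^ 2 + q r ^ 2)) := by
  have hA : 0 ≤ ∫ r in Set.Ioo (0 : ℝ) 1, aD x y x1 y1 r :=
    setIntegral_nonneg measurableSet_Ioo (fun r hr => a_nonneg hr)
  have hB : 0 ≤ ∫ r in Set.Ioo (0 : ℝ) 1, bD x y r :=
    setIntegral_nonneg measurableSet_Ioo (fun r hr => b_nonneg hr)
  have hK : 0 ≤ ∫ r in Set.Ioo (0 : ℝ) 1, kD x y r :=
    setIntegral_nonneg measurableSet_Ioo (fun r hr =>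
      mul_nonneg (by nlinarith [hr.1, hr.2]) (b_nonneg hr))
  have hQ : 0 ≤ ∫ r in Set.Ioo (0 : ℝ) 1, r * (p r ^ 2 + q r ^ 2) :=
    setIntegral_nonneg measurableSet_Ioo (fun r hr => mul_nonneg hr.1.le (by positivity))
  have hE := fun t ht => h.energy (t := t) ht
  have hI := fun t ht => h.imag (t := t) ht
  have hP := h.interp hδ
  have hW := h.wbound
  have hD := h.dbound hδ
  have hm := h.m1
  generalize (∫ r in Set.Ioo (0 : ℝ) 1, aD x y x1 y1 r) = A at *
  generalize (∫ r in Set.Ioo (0 : ℝ) 1, bD x y r) = B at *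
  generalize (∫ r in Set.Ioo (0 : ℝ) 1, kD x y r) = K at *
  generalize (∫ r in Set.Ioo (0 : ℝ) 1, wD x y x1 y1 r) = W at *
  generalize (∫ r in Set.Ioo (0 : ℝ) 1, dD m U x y r) = D at *
  generalize (∫ r in Set.Ioo (0 : ℝ) 1, r * (p r ^ 2 + q r ^ 2)) = Q at *
  have hmB : B ≤ m ^ 2 * B := le_mul_of_one_le_left hB hm
  have main : B ≤ 121 * δ ^ 4 * Q ∧ A + m ^ 2 * B ≤ 11 * δ ^ 2 * Q := by
    rcases le_total δ 1 with h1 | h1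
    · have ht : 0 < 1 / (11 * δ ^ 2) := by positivity
      have E := hE _ ht
      have I := hI _ ht
      set R := Q / (2 * (1 / (11 * δ ^ 2))) + 1 / (11 * δ ^ 2) / 2 * B with hR
      have hKR : K ≤ δ ^ 3 * R := by
        have := mul_le_mul_of_nonneg_left I (by positivity : 0 ≤ δ ^ 3)
        calc K = δ ^ 3 * (|m| * c * K) := by linear_combination (-K) * hδ3
          _ ≤ _ := this
      have hAR : A ≤ R := by nlinarith
      have h2 : (6 + 4 / δ) * K ≤ 10 / δ * K := by
        apply mul_le_mul_of_nonneg_right _ hK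
        have : 1 ≤ 1 / δ := by rw [le_div_iff₀ hδ]; linarith
        have e : 10 / δ = 10 * (1 / δ) := by ring
        have e' : 4 / δ = 4 * (1 / δ) := by ring
        linarith
      have h3 : 10 / δ * K ≤ 10 / δ * (δ ^ 3 * R) := mul_le_mul_of_nonneg_left hKR (by positivity)
      have e3 : 10 / δ * (δ ^ 3 * R) = 10 * δ ^ 2 * R := by field_simp
      have h4 : δ ^ 2 * A ≤ δ ^ 2 * R := mul_le_mul_of_nonneg_left hAR (by positivity)
      have e4 : 11 * δ ^ 2 * R = 121 * δ ^ 4 * Q / 2 + B / 2 := by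
        rw [hR]; field_simp; ring
      have hBf : B ≤ 121 * δ ^ 4 * Q := by linarith
      refine ⟨hBf, E.trans ?_⟩
      have h5 : 11 * δ ^ 2 * R ≤ 11 * δ ^ 2 * (11 * δ ^ 2 * Q) := by
        rw [e4]; linarith
      exact le_of_mul_le_mul_left h5 (by positivity)
    · have E := hE 1 one_pos
      have h2 : 1 ≤ δ ^ 2 := by nlinarith
      have h4 : 1 ≤ δ ^ 4 := by nlinarith
      have hBQ : B ≤ Q := by linarith
      have q2 : Q ≤ δ ^ 2 * Q := le_mul_of_one_le_left hQ h2
      have q4 : Q ≤ δ ^ 4 * Q := le_mul_of_one_le_left hQ h4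
      constructor <;> linarith
  obtain ⟨mB, mA⟩ := main
  refine ⟨mB, by linarith, ?_⟩
  have hAs : A ≤ 11 * δ ^ 2 * Q := by linarith
  have hY : 0 ≤ |m| * c := mul_nonneg (abs_nonneg _) h.c0.le
  have h1 : δ * A + B / δ ≤ 132 * δ ^ 3 * Q := by
    have u1 : δ * A ≤ δ * (11 * δ ^ 2 * Q) := mul_le_mul_of_nonneg_left hAs hδ.le
    have u2 : B / δ ≤ 121 * δ ^ 3 * Q := by
      rw [div_le_iff₀ hδ]; linarith
    linarith
  have h2 := mul_le_mul_of_nonneg_left h1 (by positivity : 0 ≤ 4 * (|m| * c))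
  have e : 4 * (|m| * c) * (132 * δ ^ 3 * Q) = 528 * Q := by
    linear_combination 528 * Q * hδ3
  linarith

end RealSol
end

lemma wInt_eq {h g : ℝ → ℝ} (e : ∀ r ∈ Set.Ioo (0 : ℝ) 1, h r = g r)
    (hi : IntegrableOn g (Set.Ioo 0 1)) (hg : ∀ r ∈ Set.Ioo (0 : ℝ) 1, 0 ≤ g r) :
    wInt h = ENNReal.ofReal (∫ r in Set.Ioo (0 : ℝ) 1, g r) := by
  unfold wInt
  rw [ofReal_integral_eq_lintegral_ofReal hi
    ((ae_restrict_iff' measurableSet_Ioo).2 (Eventually.of_forall hg))]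
  exact setLIntegral_congr_fun measurableSet_Ioo (fun r hr => by simp only [e r hr])

lemma integrable_of_wInt {h g : ℝ → ℝ} (e : ∀ r ∈ Set.Ioo (0 : ℝ) 1, h r = g r)
    (hc : ContinuousOn g (Set.Ioo 0 1)) (hg : ∀ r ∈ Set.Ioo (0 : ℝ) 1, 0 ≤ g r)
    (hf : wInt h < ⊤) : IntegrableOn g (Set.Ioo 0 1) := by
  refine ⟨hc.aestronglyMeasurable measurableSet_Ioo, ?_⟩
  rw [hasFiniteIntegral_iff_ofReal
    ((ae_restrict_iff' measurableSet_Ioo).2 (Eventually.of_forall hg))]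
  refine lt_of_eq_of_lt ?_ hf
  exact setLIntegral_congr_fun measurableSet_Ioo (fun r hr => by simp only [e r hr])

lemma cont_update {g : ℝ → ℂ} {L : ℂ} (hg : ContinuousOn g (Set.Ioc 0 1))
    (ht : Tendsto g (nhdsWithin (0 : ℝ) (Set.Ioc 0 1)) (nhds L)) :
    ContinuousOn (Function.update g 0 L) (Set.Icc 0 1) := by
  have e : Set.Icc (0 : ℝ) 1 \ {0} = Set.Ioc 0 1 := by
    ext r; simp only [Set.mem_sdiff, Set.mem_Icc, Set.mem_singleton_iff, Set.mem_Ioc]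
    constructor
    · rintro ⟨⟨h1, h2⟩, h3⟩; exact ⟨lt_of_le_of_ne h1 (Ne.symm h3), h2⟩
    · rintro ⟨h1, h2⟩; exact ⟨⟨h1.le, h2⟩, h1.ne'⟩
  rw [continuousOn_update_iff, e]
  exact ⟨hg, fun _ => ht⟩

lemma swirl_deriv_update {g : ℝ → ℂ} {L d : ℂ} {r : ℝ} (hr : 0 < r) (hg : HasDerivAt g d r) :
    HasDerivAt (Function.update g 0 L) d r := by
  refine hg.congr_of_eventuallyEq ?_
  filter_upwards [eventually_ne_nhds hr.ne'] with s hs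
  exact Function.update_of_ne hs _ _

lemma re_deriv {g : ℝ → ℂ} {d : ℂ} {r : ℝ} (hg : HasDerivAt g d r) :
    HasDerivAt (fun r => (g r).re) d.re r :=
  (Complex.reCLM.hasFDerivAt.comp_hasDerivAt r hg)

lemma im_deriv {g : ℝ → ℂ} {d : ℂ} {r : ℝ} (hg : HasDerivAt g d r) :
    HasDerivAt (fun r => (g r).im) d.im r :=
  (Complex.imCLM.hasFDerivAt.comp_hasDerivAt r hg)

lemma dz_hasDerivAt {g : ℝ → ℂ} (hg : DifferentiableOn ℝ g (Set.Ioc 0 1)) {r : ℝ}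
    (hr : r ∈ Set.Ioo (0 : ℝ) 1) : HasDerivAt g (dz g r) r :=
  ((hg r ⟨hr.1, hr.2.le⟩).hasDerivWithinAt).hasDerivAt (Ioc_mem_nhds hr.1 hr.2)

lemma Ubar_deriv (Φ α r : ℝ) : HasDerivAt (Ubar Φ α)
    ((4 + 2 * α) / (4 + α) * (-(2 * α / (4 + 2 * α) * (2 * r))) * (Φ / Real.pi)) r := by
  have h1 : HasDerivAt (fun r : ℝ => 1 - 2 * α / (4 + 2 * α) * r ^ 2)
      (-(2 * α / (4 + 2 * α) * (2 * r))) r := by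
    simpa using (((hasDerivAt_id' r).pow 2).const_mul (2 * α / (4 + 2 * α))).const_sub 1
  exact ((h1.const_mul _).mul_const _)

lemma Ubar_low {Φ α r : ℝ} (hΦ : 0 < Φ) (hα : 0 ≤ α) (hr : r ∈ Set.Ioo (0 : ℝ) 1) :
    Φ / Real.pi * (1 - r ^ 2) ≤ Ubar Φ α r := by
  have hc : 0 < Φ / Real.pi := div_pos hΦ Real.pi_pos
  unfold Ubar
  rw [mul_comm]
  refine mul_le_mul_of_nonneg_right ?_ hc.le
  have e : (4 + 2 * α) / (4 + α) * (1 - 2 * α / (4 + 2 * α) * r ^ 2) - (1 - r ^ 2)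
    = (α * (1 - r ^ 2) + 4 * r ^ 2) / (4 + α) := by field_simp; ring
  have hs : 0 ≤ 1 - r ^ 2 := by nlinarith [hr.1, hr.2]
  rw [← sub_nonneg, e]; positivity

lemma Ubar_deriv_le {Φ α r : ℝ} (hΦ : 0 < Φ) (hα : 0 ≤ α) (hr : r ∈ Set.Ioo (0 : ℝ) 1) :
    |(4 + 2 * α) / (4 + α) * (-(2 * α / (4 + 2 * α) * (2 * r))) * (Φ / Real.pi)|
      ≤ 4 * (Φ / Real.pi) * r := by
  have hc : 0 < Φ / Real.pi := div_pos hΦ Real.pi_pos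
  generalize Φ / Real.pi = c at *
  have hr0 := hr.1
  have e : (4 + 2 * α) / (4 + α) * (-(2 * α / (4 + 2 * α) * (2 * r))) * c
    = -(4 * c * r * (α / (4 + α))) := by field_simp; ring
  rw [e, abs_neg, abs_of_nonneg (by positivity)]
  apply mul_le_of_le_one_right (by positivity)
  rw [div_le_one (by positivity)]; linarith

lemma SwirlSol.toReal {Φ α : ℝ} {n : ℤ} {F v : ℝ → ℂ} (hΦ : 0 < Φ) (hα : 0 ≤ α) (hn : n ≠ 0)
    (hF : ContinuousOn F (Set.Ioo 0 1)) (hFi : wInt (fun r => ‖F r‖ ^ 2 * r) < ⊤)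
    (h : SwirlSol Φ α n F v) :
    ∃ x y x1 y1 : ℝ → ℝ,
      RealSol (n : ℝ) (Φ / Real.pi) α (Ubar Φ α)
        (fun r => (4 + 2 * α) / (4 + α) * (-(2 * α / (4 + 2 * α) * (2 * r))) * (Φ / Real.pi))
        x y x1 y1 (fun r => (dz (dz v) r).re) (fun r => (dz (dz v) r).im)
        (fun r => (F r).re) (fun r => (F r).im) ∧
      (∀ r ∈ Set.Ioo (0 : ℝ) 1, (v r).re = x r ∧ (v r).im = y r) ∧
      (∀ r ∈ Set.Ioo (0 : ℝ) 1, ‖dz (fun s => (s : ℂ) * v s) r‖ ^ 2 / r = wD x y x1 y1 r) := by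
  obtain ⟨L, hL⟩ := h.ext_dv
  have hd : DifferentiableOn ℝ v (Set.Ioc 0 1) := h.smooth.differentiableOn (by norm_num)
  have h1 : ContDiffOn ℝ 1 (dz v) (Set.Ioc 0 1) :=
    h.smooth.derivWithin (uniqueDiffOn_Ioc 0 1) (by norm_num)
  have hd1 : DifferentiableOn ℝ (dz v) (Set.Ioc 0 1) := h1.differentiableOn (by norm_num)
  have hV := cont_update h.smooth.continuousOn h.ext_v
  have hV1 := cont_update h1.continuousOn hL
  set V := Function.update v 0 0 with hVdef
  set V1 := Function.update (dz v) 0 L with hV1def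
  have eV : ∀ r : ℝ, 0 < r → V r = v r := fun r hr => Function.update_of_ne hr.ne' _ _
  have eV1 : ∀ r : ℝ, 0 < r → V1 r = dz v r := fun r hr => Function.update_of_ne hr.ne' _ _
  have V0 : V 0 = 0 := Function.update_self _ _ _
  have dV : ∀ r ∈ Set.Ioo (0 : ℝ) 1, HasDerivAt V (V1 r) r := fun r hr => by
    rw [eV1 r hr.1]; exact swirl_deriv_update hr.1 (dz_hasDerivAt hd hr)
  have dV1 : ∀ r ∈ Set.Ioo (0 : ℝ) 1, HasDerivAt V1 (dz (dz v) r) r := fun r hr =>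
    swirl_deriv_update hr.1 (dz_hasDerivAt hd1 hr)
  have cre : ContinuousOn (fun r => (V r).re) (Set.Icc 0 1) :=
    Complex.continuous_re.comp_continuousOn hV
  have cim : ContinuousOn (fun r => (V r).im) (Set.Icc 0 1) :=
    Complex.continuous_im.comp_continuousOn hV
  have cre1 : ContinuousOn (fun r => (V1 r).re) (Set.Icc 0 1) :=
    Complex.continuous_re.comp_continuousOn hV1
  have cim1 : ContinuousOn (fun r => (V1 r).im) (Set.Icc 0 1) :=
    Complex.continuous_im.comp_continuousOn hV1
  have ew : ∀ r ∈ Set.Ioo (0 : ℝ) 1, ‖dz (fun s => (s : ℂ) * v s) r‖ ^ 2 / r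
      = wD (fun r => (V r).re) (fun r => (V r).im) (fun r => (V1 r).re)
        (fun r => (V1 r).im) r := by
    intro r hr
    have hda : HasDerivAt (fun s : ℝ => (s : ℂ) * v s) (1 * v r + (r : ℂ) * dz v r) r :=
      (Complex.ofRealCLM.hasDerivAt).mul (dz_hasDerivAt hd hr)
    have e : dz (fun s => (s : ℂ) * v s) r = 1 * v r + (r : ℂ) * dz v r :=
      hda.hasDerivWithinAt.derivWithin (uniqueDiffOn_Ioc 0 1 r ⟨hr.1, hr.2.le⟩)
    rw [e, Complex.sq_norm, Complex.normSq_apply]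
    unfold wD
    simp only [eV r hr.1, eV1 r hr.1]
    simp
    ring
  have iw := integrable_of_wInt ew (by
      unfold wD
      have hs := Set.Ioo_subset_Icc_self (a := (0 : ℝ)) (b := 1)
      have c1 := cre.mono hs; have c2 := cim.mono hs
      have c3 := cre1.mono hs; have c4 := cim1.mono hs
      exact ContinuousOn.div (by fun_prop) continuousOn_id (fun r hr => hr.1.ne'))
    (fun r hr => div_nonneg (by positivity) hr.1.le) h.fin_dv
  have ia : IntegrableOn (aD (fun r => (V r).re) (fun r => (V r).im) (fun r => (V1 r).re)
        (fun r => (V1 r).im)) (Set.Ioo 0 1) := by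
    have i4 : IntegrableOn (fun r => 4 * ((V r).re * (V1 r).re + (V r).im * (V1 r).im))
        (Set.Ioo 0 1) := by
      apply cont_int; fun_prop
    exact (isub iw i4).congr_fun (fun r hr => by
      simp only [RealSol.wD_eq hr.1.ne']; ring) measurableSet_Ioo
  have jf : IntegrableOn (fun r => r * ((F r).re ^ 2 + (F r).im ^ 2)) (Set.Ioo 0 1) := by
    refine integrable_of_wInt (h := fun r => ‖F r‖ ^ 2 * r) ?_ ?_ ?_ hFi
    · intro r hr
      simp only [Complex.sq_norm, Complex.normSq_apply]; ring
    · have c1 : ContinuousOn (fun r => (F r).re) (Set.Ioo 0 1) :=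
        Complex.continuous_re.comp_continuousOn hF
      have c2 : ContinuousOn (fun r => (F r).im) (Set.Ioo 0 1) :=
        Complex.continuous_im.comp_continuousOn hF
      fun_prop
    · exact fun r hr => mul_nonneg hr.1.le (by positivity)
  have eqre : ∀ r ∈ Set.Ioo (0 : ℝ) 1, (F r).re = -(n * Ubar Φ α r * (v r).im)
      - ((dz (dz v) r).re + r⁻¹ * (dz v r).re - (r ^ 2)⁻¹ * (v r).re - n ^ 2 * (v r).re) := by
    intro r hr
    rw [← h.eqn r hr]
    unfold Lop
    have e1 : ((r : ℂ))⁻¹ = ((r⁻¹ : ℝ) : ℂ) := by push_cast; rfl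
    have e2 : ((r : ℂ) ^ 2)⁻¹ = (((r ^ 2)⁻¹ : ℝ) : ℂ) := by push_cast; rfl
    have e3 : (n : ℂ) = ((n : ℝ) : ℂ) := by push_cast; rfl
    have e4 : (n : ℂ) ^ 2 = (((n : ℝ) ^ 2 : ℝ) : ℂ) := by push_cast; rfl
    rw [e1, e2, e4, e3]
    generalize Ubar Φ α r = u
    generalize (r ^ 2)⁻¹ = s
    generalize r⁻¹ = t
    generalize (n : ℝ) ^ 2 = k
    simp only [Complex.sub_re, Complex.add_re, Complex.mul_re, Complex.mul_im, Complex.ofReal_re,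
      Complex.ofReal_im, Complex.I_re, Complex.I_im]
    ring
  have eqim : ∀ r ∈ Set.Ioo (0 : ℝ) 1, (F r).im = (n * Ubar Φ α r * (v r).re)
      - ((dz (dz v) r).im + r⁻¹ * (dz v r).im - (r ^ 2)⁻¹ * (v r).im - n ^ 2 * (v r).im) := by
    intro r hr
    rw [← h.eqn r hr]
    unfold Lop
    have e1 : ((r : ℂ))⁻¹ = ((r⁻¹ : ℝ) : ℂ) := by push_cast; rfl
    have e2 : ((r : ℂ) ^ 2)⁻¹ = (((r ^ 2)⁻¹ : ℝ) : ℂ) := by push_cast; rfl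
    have e3 : (n : ℂ) = ((n : ℝ) : ℂ) := by push_cast; rfl
    have e4 : (n : ℂ) ^ 2 = (((n : ℝ) ^ 2 : ℝ) : ℂ) := by push_cast; rfl
    rw [e1, e2, e4, e3]
    generalize Ubar Φ α r = u
    generalize (r ^ 2)⁻¹ = s
    generalize r⁻¹ = t
    generalize (n : ℝ) ^ 2 = k
    simp only [Complex.sub_im, Complex.add_im, Complex.mul_re, Complex.mul_im, Complex.ofReal_re,
      Complex.ofReal_im, Complex.I_re, Complex.I_im]
    ring
  have hbc : V1 1 = ((1 - α : ℝ) : ℂ) * V 1 := by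
    rw [eV1 1 one_pos, eV 1 one_pos, h.bc]; push_cast; rfl
  refine ⟨fun r => (V r).re, fun r => (V r).im, fun r => (V1 r).re, fun r => (V1 r).im,
    { cx := cre, cy := cim, cx1 := cre1, cy1 := cim1
      cU := fun r _ => (Ubar_deriv Φ α r).continuousAt.continuousWithinAt
      x0 := by simp [V0]
      y0 := by simp [V0]
      dx := fun r hr => re_deriv (dV r hr)
      dy := fun r hr => im_deriv (dV r hr)
      dx1 := fun r hr => re_deriv (dV1 r hr)
      dy1 := fun r hr => im_deriv (dV1 r hr)
      dU := fun r _ => Ubar_deriv Φ α r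
      Ulow := fun r hr => Ubar_low hΦ hα hr
      U1le := fun r hr => Ubar_deriv_le hΦ hα hr
      e1 := fun r hr => by
        simp only [eV r hr.1, eV1 r hr.1, eqre r hr]; ring
      e2 := fun r hr => by
        simp only [eV r hr.1, eV1 r hr.1, eqim r hr]; ring
      b1 := by simp only [hbc, Complex.re_ofReal_mul]
      b2 := by simp only [hbc, Complex.im_ofReal_mul]
      c0 := div_pos hΦ Real.pi_pos
      α0 := hα
      m1 := by
        have : 1 ≤ |n| := Int.one_le_abs hn
        have h2 : (1 : ℝ) ≤ |(n : ℝ)| := by exact_mod_cast this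
        rw [← sq_abs]; nlinarith
      ia := ia
      jf := jf }, fun r hr => ⟨by simp only [eV r hr.1], by simp only [eV r hr.1]⟩, ew⟩

lemma delta_exists {X : ℝ} (hX : 0 < X) : ∃ δ : ℝ, 0 < δ ∧ X / Real.pi * δ ^ 3 = 1 ∧
    δ ^ 4 ≤ 16 * X ^ (-(4 / 3) : ℝ) ∧ δ ^ 2 ≤ 4 * X ^ (-(2 / 3) : ℝ) := by
  have hp := Real.pi_pos
  set η := X ^ (-(1 / 3) : ℝ) with hη
  set ρ := Real.pi ^ (1 / 3 : ℝ) with hρ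
  have η0 : 0 < η := Real.rpow_pos_of_pos hX _
  have ρ0 : 0 < ρ := Real.rpow_pos_of_pos hp _
  have hη3 : η ^ 3 = X⁻¹ := by
    rw [hη, ← Real.rpow_mul_natCast hX.le, ← Real.rpow_neg_one]; norm_num
  have hη4 : η ^ 4 = X ^ (-(4 / 3) : ℝ) := by
    rw [hη, ← Real.rpow_mul_natCast hX.le]; norm_num
  have hη2 : η ^ 2 = X ^ (-(2 / 3) : ℝ) := by
    rw [hη, ← Real.rpow_mul_natCast hX.le]; norm_num
  have hρ3 : ρ ^ 3 = Real.pi := by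
    rw [hρ, ← Real.rpow_mul_natCast hp.le]; norm_num
  have hρ2 : ρ ≤ 2 := by
    by_contra hcon
    push Not at hcon
    have : (2 : ℝ) ^ 3 < ρ ^ 3 := pow_lt_pow_left₀ hcon (by norm_num) (by norm_num)
    rw [hρ3] at this
    linarith [Real.pi_le_four]
  refine ⟨η * ρ, by positivity, ?_, ?_, ?_⟩
  · rw [mul_pow, hη3, hρ3]; field_simp
  · rw [mul_pow, ← hη4, mul_comm]
    have : ρ ^ 4 ≤ 2 ^ 4 := pow_le_pow_left₀ ρ0.le hρ2 4
    exact mul_le_mul_of_nonneg_right (by linarith) (by positivity)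
  · rw [mul_pow, ← hη2, mul_comm]
    have : ρ ^ 2 ≤ 2 ^ 2 := pow_le_pow_left₀ ρ0.le hρ2 2
    exact mul_le_mul_of_nonneg_right (by linarith) (by positivity)

/-- Estimates (swirl-36), (swirl-37), (swirl-39) from the proof of Proposition 4.1:
uniform estimates for the nonzero modes of the swirl velocity. -/
theorem swirl_mode_estimates :
    ∃ C : ℝ, 0 < C ∧ ∀ (Φ α : ℝ) (n : ℤ) (F v : ℝ → ℂ),
      0 < Φ → 0 ≤ α → n ≠ 0 →
      ContinuousOn F (Set.Ioo 0 1) → wInt (fun r => ‖F r‖ ^ 2 * r) < ⊤ →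
      SwirlSol Φ α n F v →
      (wInt (fun r => ‖v r‖ ^ 2 * r)
        ≤ ENNReal.ofReal (C * (Φ * |(n : ℝ)|) ^ (-(4 / 3) : ℝ))
            * wInt (fun r => ‖F r‖ ^ 2 * r)) ∧
      (wInt (fun r => ‖dz (fun s => (s : ℂ) * v s) r‖ ^ 2 / r)
          + ENNReal.ofReal ((n : ℝ) ^ 2) * wInt (fun r => ‖v r‖ ^ 2 * r)
        ≤ ENNReal.ofReal (C * (Φ * |(n : ℝ)|) ^ (-(2 / 3) : ℝ))
            * wInt (fun r => ‖F r‖ ^ 2 * r)) ∧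
      (wInt (fun r => ‖Lop v r - (n : ℂ) ^ 2 * v r‖ ^ 2 * r)
        ≤ ENNReal.ofReal C * wInt (fun r => ‖F r‖ ^ 2 * r)) := by
  refine ⟨2000, by norm_num, ?_⟩
  intro Φ α n F v hΦ hα hn hF hFi h
  obtain ⟨x, y, x1, y1, hR, hv, hw⟩ := h.toReal hΦ hα hn hF hFi
  have hn' : 0 < |(n : ℝ)| := abs_pos.2 (by exact_mod_cast hn)
  obtain ⟨δ, hδ, hδ3, hδ4, hδ2⟩ := delta_exists (mul_pos hΦ hn')
  obtain ⟨f1, f2, f3⟩ := hR.final hδ (by rw [← hδ3]; ring)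
  have eQ := wInt_eq (h := fun r => ‖F r‖ ^ 2 * r)
    (g := fun r => r * ((F r).re ^ 2 + (F r).im ^ 2)) (fun r _ => by
      simp only [Complex.sq_norm, Complex.normSq_apply]; ring) hR.jf
    (fun r hr => mul_nonneg hr.1.le (by positivity))
  have eB := wInt_eq (h := fun r => ‖v r‖ ^ 2 * r) (g := bD x y) (fun r hr => by
      simp only [Complex.sq_norm, Complex.normSq_apply, (hv r hr).1, (hv r hr).2]
      unfold bD; ring) hR.ib (fun r hr => RealSol.b_nonneg hr)
  have w0 : ∀ r ∈ Set.Ioo (0 : ℝ) 1, 0 ≤ wD x y x1 y1 r :=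
    fun r hr => div_nonneg (by positivity) hr.1.le
  have eW := wInt_eq hw hR.iw w0
  have hQ : 0 ≤ ∫ r in Set.Ioo (0 : ℝ) 1, r * ((F r).re ^ 2 + (F r).im ^ 2) :=
    setIntegral_nonneg measurableSet_Ioo (fun r hr => mul_nonneg hr.1.le (by positivity))
  have hB : 0 ≤ ∫ r in Set.Ioo (0 : ℝ) 1, bD x y r :=
    setIntegral_nonneg measurableSet_Ioo (fun r hr => RealSol.b_nonneg hr)
  have hW : 0 ≤ ∫ r in Set.Ioo (0 : ℝ) 1, wD x y x1 y1 r :=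
    setIntegral_nonneg measurableSet_Ioo w0
  have p4 : 0 < (Φ * |(n : ℝ)|) ^ (-(4 / 3) : ℝ) := Real.rpow_pos_of_pos (mul_pos hΦ hn') _
  have p2 : 0 < (Φ * |(n : ℝ)|) ^ (-(2 / 3) : ℝ) := Real.rpow_pos_of_pos (mul_pos hΦ hn') _
  refine ⟨?_, ?_, ?_⟩
  · rw [eB, eQ, ← ENNReal.ofReal_mul (by positivity)]
    refine ENNReal.ofReal_le_ofReal (f1.trans ?_)
    exact mul_le_mul_of_nonneg_right (by linarith) hQ
  · rw [eW, eB, eQ, ← ENNReal.ofReal_mul (by positivity), ← ENNReal.ofReal_mul (by positivity),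
      ← ENNReal.ofReal_add hW (by positivity)]
    refine ENNReal.ofReal_le_ofReal (f2.trans ?_)
    exact mul_le_mul_of_nonneg_right (by linarith) hQ
  · have i2 := iadd (hR.id'.const_mul 2) (hR.jf.const_mul 2)
    have eS := wInt_eq (fun r _ => rfl) i2 (fun r hr => by
      have := RealSol.b_nonneg (x := x) (y := y) hr
      have := hr.1
      unfold dD; positivity)
    calc _ ≤ wInt (fun r => 2 * dD (n : ℝ) (Ubar Φ α) x y r
            + 2 * (r * ((F r).re ^ 2 + (F r).im ^ 2))) := by
          unfold wInt
          refine setLIntegral_mono' measurableSet_Ioo (fun r hr => ENNReal.ofReal_le_ofReal ?_)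
          have e : Lop v r - (n : ℂ) ^ 2 * v r
              = Complex.I * (n : ℂ) * (Ubar Φ α r : ℂ) * v r - F r := by
            rw [← h.eqn r hr]; ring
          have e3 : (n : ℂ) = ((n : ℝ) : ℂ) := by push_cast; rfl
          beta_reduce
          rw [e, Complex.sq_norm, Complex.normSq_apply, e3]
          unfold dD bD
          rw [← (hv r hr).1, ← (hv r hr).2]
          generalize Ubar Φ α r = u
          generalize (n : ℝ) = k
          simp only [Complex.sub_re, Complex.sub_im, Complex.mul_re, Complex.mul_im,
            Complex.ofReal_re, Complex.ofReal_im, Complex.I_re, Complex.I_im]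
          have : 0 ≤ r * ((-(k * u * (v r).im) + (F r).re) ^ 2
            + (k * u * (v r).re + (F r).im) ^ 2) := mul_nonneg hr.1.le (by positivity)
          linarith
      _ ≤ _ := by
          rw [eS, eQ, ← ENNReal.ofReal_mul (by norm_num)]
          refine ENNReal.ofReal_le_ofReal ?_
          rw [integral_add (hR.id'.const_mul 2) (hR.jf.const_mul 2), integral_const_mul,
            integral_const_mul]
          linarith
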